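/- Let f_1,…,f_m, N_1,…,N_m, s, c be a local model, let (x^{(1)},y^{(1)}),…,(x^{(n)},y^{(n)}) be a dataset with loss L, let Θ : [0,∞) → ℝ^p be a gradient flow trajectory of L, and let Θ̄ be the gradient flow trajectory of the linearized loss L̄ with Θ̄(0) = Θ(0). Then the deviation Δ(t) = ((1/n) Σ_{i=1}^n (f(Θ(t),x^{(i)}) − f̄(Θ̄(t),x^{(i)}))²)^{1/2} between the model and its linearization satisfies, for all t ≥ 0, Δ(t) ≤ 4·s⁴·c³·L(Θ(0))·t² / √m. -/

import Mathlib

open Real MeasureTheory ProbabilityTheory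

/-- Partial derivative of `g : ℝ^p → ℝ` with respect to the `j`-th coordinate. -/
noncomputable def pder {p : ℕ} (j : Fin p) (g : (Fin p → ℝ) → ℝ) (Θ : Fin p → ℝ) : ℝ :=
  fderiv ℝ g Θ (Pi.single j 1)

/-- The model function `f(Θ,x) = m^{-1/2} ∑_k f_k(Θ,x)`. -/
noncomputable def modelF {m p d : ℕ} (f : Fin m → (Fin p → ℝ) → (Fin d → ℝ) → ℝ)
    (Θ : Fin p → ℝ) (x : Fin d → ℝ) : ℝ :=
  (Real.sqrt m)⁻¹ * ∑ k, f k Θ x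

/-- The tangent kernel `K_Θ(x,x') = ∑_j ∂_{θ_j} f(Θ,x) ⬝ ∂_{θ_j} f(Θ,x')`. -/
noncomputable def kernelK {m p d : ℕ} (f : Fin m → (Fin p → ℝ) → (Fin d → ℝ) → ℝ)
    (Θ : Fin p → ℝ) (x x' : Fin d → ℝ) : ℝ :=
  ∑ j : Fin p, pder j (fun Θ' => modelF f Θ' x) Θ * pder j (fun Θ' => modelF f Θ' x') Θ

/-- A local model: each `f_k` is C², depends only on the parameters in `N k`,
`|N k| ≤ s`, each parameter appears in at most `s` of the `N k`'s, and all first and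
second partial derivatives of the `f_k` are bounded by `c`. -/
def IsLocalModel {m p d : ℕ} (f : Fin m → (Fin p → ℝ) → (Fin d → ℝ) → ℝ)
    (N : Fin m → Finset (Fin p)) (s c : ℝ) : Prop :=
  (∀ k x, ContDiff ℝ 2 fun Θ => f k Θ x) ∧
  (∀ k x (Θ Θ' : Fin p → ℝ), (∀ j ∈ N k, Θ j = Θ' j) → f k Θ x = f k Θ' x) ∧
  (∀ k, ((N k).card : ℝ) ≤ s) ∧
  (∀ j : Fin p, ((Finset.univ.filter fun k => j ∈ N k).card : ℝ) ≤ s) ∧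
  (∀ k j Θ x, |pder j (fun Θ' => f k Θ' x) Θ| ≤ c) ∧
  (∀ k i j Θ x, |pder i (fun Θ' => pder j (fun Θ'' => f k Θ'' x) Θ') Θ| ≤ c)

/-- The mean squared error loss `L(Θ) = (1/n) ∑_i ½(f(Θ,x⁽ⁱ⁾) − y⁽ⁱ⁾)²`. -/
noncomputable def lossL {m p d n : ℕ} (f : Fin m → (Fin p → ℝ) → (Fin d → ℝ) → ℝ)
    (X : Fin n → Fin d → ℝ) (Y : Fin n → ℝ) (Θ : Fin p → ℝ) : ℝ :=
  (n : ℝ)⁻¹ * ∑ i, (1 / 2) * (modelF f Θ (X i) - Y i) ^ 2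

/-- The linearization of the model at `Θ₀`:
`f̄(Θ̄,x) = f(Θ₀,x) + ∇_Θ f(Θ₀,x) ⬝ (Θ̄ − Θ₀)`. -/
noncomputable def linF {m p d : ℕ} (f : Fin m → (Fin p → ℝ) → (Fin d → ℝ) → ℝ)
    (Θ₀ Θbar : Fin p → ℝ) (x : Fin d → ℝ) : ℝ :=
  modelF f Θ₀ x + ∑ j : Fin p, pder j (fun Θ' => modelF f Θ' x) Θ₀ * (Θbar j - Θ₀ j)

/-- The loss of the linearized model. -/
noncomputable def linLoss {m p d n : ℕ} (f : Fin m → (Fin p → ℝ) → (Fin d → ℝ) → ℝ)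
    (Θ₀ : Fin p → ℝ) (X : Fin n → Fin d → ℝ) (Y : Fin n → ℝ) (Θbar : Fin p → ℝ) : ℝ :=
  (n : ℝ)⁻¹ * ∑ i, (1 / 2) * (linF f Θ₀ Θbar (X i) - Y i) ^ 2

/-- The root mean squared deviation between the model along `Θ` and the linearized model
along `Θbar`. -/
noncomputable def devΔ {m p d n : ℕ} (f : Fin m → (Fin p → ℝ) → (Fin d → ℝ) → ℝ)
    (X : Fin n → Fin d → ℝ) (Θ Θbar : ℝ → Fin p → ℝ) (t : ℝ) : ℝ :=
  Real.sqrt ((n : ℝ)⁻¹ * ∑ i, (modelF f (Θ t) (X i) - linF f (Θ 0) (Θbar t) (X i)) ^ 2)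

theorem hasDerivAt_comp_pder {p : ℕ} {g : (Fin p → ℝ) → ℝ} {Θ : ℝ → Fin p → ℝ} {v : Fin p → ℝ}
    {t : ℝ} (hg : DifferentiableAt ℝ g (Θ t)) (hΘ : ∀ j, HasDerivAt (fun u => Θ u j) (v j) t) :
    HasDerivAt (fun u => g (Θ u)) (∑ j, pder j g (Θ t) * v j) t := by
  have h := hg.hasFDerivAt.comp_hasDerivAt t (hasDerivAt_pi.2 hΘ)
  refine h.congr_deriv ?_
  have hv : v = ∑ j, v j • Pi.single j (1 : ℝ) := by
    ext i
    simp [Pi.single_apply]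
  conv_lhs => rw [hv, map_sum]
  refine Finset.sum_congr rfl fun j _ => ?_
  rw [map_smul, smul_eq_mul, mul_comm, pder]

theorem contDiff_pder {p : ℕ} {g : (Fin p → ℝ) → ℝ} (hg : ContDiff ℝ 2 g) (j : Fin p) :
    ContDiff ℝ 1 (pder j g) :=
  (hg.fderiv_right (m := 1) (by norm_num)).clm_apply contDiff_const

theorem pder_eq_of_forall_mem {p : ℕ} {g : (Fin p → ℝ) → ℝ} {S : Finset (Fin p)}
    (hS : ∀ Θ Θ' : Fin p → ℝ, (∀ j ∈ S, Θ j = Θ' j) → g Θ = g Θ') (i : Fin p)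
    {Θ Θ' : Fin p → ℝ} (h : ∀ j ∈ S, Θ j = Θ' j) : pder i g Θ = pder i g Θ' := by
  have hg : g = fun Ψ => g (Ψ + (Θ' - Θ)) := by
    ext Ψ
    exact hS _ _ fun j hj => by simp [h j hj]
  unfold pder
  conv_lhs => rw [hg, fderiv_comp_add_right]
  simp

theorem pder_eq_zero_of_notMem {p : ℕ} {g : (Fin p → ℝ) → ℝ} {S : Finset (Fin p)}
    (hg : Differentiable ℝ g)
    (hS : ∀ Θ Θ' : Fin p → ℝ, (∀ j ∈ S, Θ j = Θ' j) → g Θ = g Θ') {i : Fin p} (hi : i ∉ S)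
    (Θ : Fin p → ℝ) : pder i g Θ = 0 := by
  rw [pder, ← (hg Θ).lineDeriv_eq_fderiv, lineDeriv]
  have : (fun t : ℝ => g (Θ + t • Pi.single i 1)) = fun _ => g Θ := by
    ext t
    refine hS _ _ fun j hj => ?_
    have : j ≠ i := fun h => hi (h ▸ hj)
    simp [this]
  rw [this, deriv_const]

/-- A function depending only on the coordinates in `S`, with partial derivatives bounded by `c`,
is `c`-Lipschitz for the `ℓ¹` distance of these coordinates. -/
theorem abs_sub_le_of_abs_pder_le {p : ℕ} {g : (Fin p → ℝ) → ℝ} {S : Finset (Fin p)} {c : ℝ}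
    (hg : Differentiable ℝ g)
    (hS : ∀ Θ Θ' : Fin p → ℝ, (∀ j ∈ S, Θ j = Θ' j) → g Θ = g Θ')
    (hc : ∀ i Θ, |pder i g Θ| ≤ c) (Θ Θ' : Fin p → ℝ) :
    |g Θ - g Θ'| ≤ c * ∑ i ∈ S, |Θ i - Θ' i| := by
  have hd : ∀ u : ℝ, HasDerivAt (fun u : ℝ => g (fun i => Θ' i + u * (Θ i - Θ' i)))
      (∑ j, pder j g (fun i => Θ' i + u * (Θ i - Θ' i)) * (Θ j - Θ' j)) u := fun u =>
    hasDerivAt_comp_pder (Θ := fun (u : ℝ) i => Θ' i + u * (Θ i - Θ' i)) (hg _) fun j => by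
      simpa using ((hasDerivAt_id u).mul_const (Θ j - Θ' j)).const_add (Θ' j)
  have h := norm_image_sub_le_of_norm_deriv_le_segment_01'
    (C := c * ∑ i ∈ S, |Θ i - Θ' i|) (fun u _ => (hd u).hasDerivWithinAt) (fun u _ => by
      rw [← Finset.sum_subset (Finset.subset_univ S) (fun j _ hj => by
        rw [pder_eq_zero_of_notMem hg hS hj, zero_mul]), Real.norm_eq_abs, Finset.mul_sum]
      refine (Finset.abs_sum_le_sum_abs _ _).trans (Finset.sum_le_sum fun j _ => ?_)
      rw [abs_mul]
      exact mul_le_mul_of_nonneg_right (hc _ _) (abs_nonneg _))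
  simpa using h

theorem pder_mean_sq {p n : ℕ} {F : Fin n → (Fin p → ℝ) → ℝ} (Y : Fin n → ℝ)
    {Θ : Fin p → ℝ} (hF : ∀ i, DifferentiableAt ℝ (F i) Θ) (j : Fin p) :
    pder j (fun Θ => (n : ℝ)⁻¹ * ∑ i, (1 / 2) * (F i Θ - Y i) ^ 2) Θ =
      (n : ℝ)⁻¹ * ∑ i, (F i Θ - Y i) * pder j (F i) Θ := by
  have h := (HasFDerivAt.fun_sum (u := Finset.univ) fun i _ =>
    ((((hF i).hasFDerivAt.sub_const (Y i)).pow 2).const_mul (1 / 2 : ℝ))).const_mul (n : ℝ)⁻¹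
  unfold pder
  rw [h.fderiv]
  simp only [smul_apply, sum_apply, smul_eq_mul]
  congr 1
  refine Finset.sum_congr rfl fun i _ => ?_
  simp
  ring

/-- The root mean square of a finite family of reals. -/
noncomputable def rootMeanSq {n : ℕ} (v : Fin n → ℝ) : ℝ :=
  Real.sqrt ((n : ℝ)⁻¹ * ∑ i, v i ^ 2)

theorem rootMeanSq_nonneg {n : ℕ} (v : Fin n → ℝ) : 0 ≤ rootMeanSq v := Real.sqrt_nonneg _

theorem rootMeanSq_sq {n : ℕ} (v : Fin n → ℝ) : rootMeanSq v ^ 2 = (n : ℝ)⁻¹ * ∑ i, v i ^ 2 :=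
  Real.sq_sqrt (by positivity)

theorem mean_abs_le_rootMeanSq {n : ℕ} (v : Fin n → ℝ) :
    (n : ℝ)⁻¹ * ∑ i, |v i| ≤ rootMeanSq v := by
  rcases n.eq_zero_or_pos with rfl | hn
  · simp [rootMeanSq]
  refine Real.le_sqrt_of_sq_le ?_
  have h := sq_sum_le_card_mul_sum_sq (s := Finset.univ) (f := fun i => |v i|)
  simp only [sq_abs, Finset.card_univ, Fintype.card_fin] at h
  have hn' : (0 : ℝ) < n := by exact_mod_cast hn
  calc ((n : ℝ)⁻¹ * ∑ i, |v i|) ^ 2 = (n : ℝ)⁻¹ ^ 2 * (∑ i, |v i|) ^ 2 := by ring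
    _ ≤ (n : ℝ)⁻¹ ^ 2 * (n * ∑ i, v i ^ 2) := by gcongr
    _ = (n : ℝ)⁻¹ * ∑ i, v i ^ 2 := by field_simp

theorem hasDerivAt_mean_sq {n : ℕ} {w : ℝ → Fin n → ℝ} {w' : Fin n → ℝ} {t : ℝ}
    (hw : ∀ i, HasDerivAt (fun u => w u i) (w' i) t) :
    HasDerivAt (fun u => (n : ℝ)⁻¹ * ∑ i, w u i ^ 2) (2 * ((n : ℝ)⁻¹ * ∑ i, w t i * w' i)) t := by
  have h := (HasDerivAt.fun_sum (u := Finset.univ) fun i _ => ((hw i).pow 2)).const_mul (n : ℝ)⁻¹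
  refine h.congr_deriv ?_
  rw [mul_left_comm, Finset.mul_sum (a := (2 : ℝ))]
  congr 1
  refine Finset.sum_congr rfl fun i _ => ?_
  simp
  ring

/-- Integrated form of the differential inequality `(g²)' ≤ 2 g A u`. -/
theorem sqrt_le_of_deriv_le {φ φ' : ℝ → ℝ} {A : ℝ} (hA : 0 ≤ A) (h0 : φ 0 = 0)
    (hφ : ∀ t, 0 ≤ t → 0 ≤ φ t) (hd : ∀ t, 0 ≤ t → HasDerivAt φ (φ' t) t)
    (hle : ∀ t, 0 ≤ t → φ' t ≤ 2 * (√(φ t) * (A * t))) {t : ℝ} (ht : 0 ≤ t) :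
    √(φ t) ≤ A * t ^ 2 / 2 := by
  have key : ∀ ε : ℝ, 0 < ε → √(φ t) ≤ A * t ^ 2 / 2 + ε := by
    intro ε hε
    have hpos : ∀ u, 0 ≤ u → 0 < φ u + ε ^ 2 := fun u hu => by
      have := hφ u hu
      positivity
    have hder : ∀ u, 0 ≤ u → HasDerivAt (fun u => √(φ u + ε ^ 2) - A * u ^ 2 / 2)
        (φ' u / (2 * √(φ u + ε ^ 2)) - A * u) u := fun u hu => by
      have h1 := ((hd u hu).add_const (ε ^ 2)).sqrt (hpos u hu).ne'
      have h2 := (((hasDerivAt_id u).pow 2).const_mul A).div_const 2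
      refine (h1.sub h2).congr_deriv ?_
      simp
      ring
    have hanti : AntitoneOn (fun u => √(φ u + ε ^ 2) - A * u ^ 2 / 2) (Set.Ici 0) := by
      refine antitoneOn_of_hasDerivWithinAt_nonpos (convex_Ici 0)
        (fun u hu => (hder u hu).continuousAt.continuousWithinAt)
        (fun u hu => (hder u (interior_subset hu)).hasDerivWithinAt) fun u hu => ?_
      have hu : 0 ≤ u := interior_subset hu
      have hs := Real.sqrt_pos.2 (hpos u hu)
      rw [sub_nonpos, div_le_iff₀ (by positivity)]
      have hmono : √(φ u) ≤ √(φ u + ε ^ 2) := Real.sqrt_le_sqrt (by nlinarith)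
      have := mul_le_mul_of_nonneg_right hmono (mul_nonneg hA hu)
      linarith [hle u hu]
    have h := hanti Set.self_mem_Ici ht ht
    simp only [h0, zero_add, Real.sqrt_sq hε.le] at h
    have hmono : √(φ t) ≤ √(φ t + ε ^ 2) := Real.sqrt_le_sqrt (by nlinarith)
    linarith
  exact le_of_forall_pos_le_add key

/-- Mean squared residuals do not increase along a gradient flow with Jacobian `J`. -/
theorem rootMeanSq_le_of_flow {n p : ℕ} {J : ℝ → Fin n → Fin p → ℝ} {r : ℝ → Fin n → ℝ}
    (hr : ∀ t, 0 ≤ t → ∀ i, HasDerivAt (fun u => r u i)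
      (∑ j, J t i j * -((n : ℝ)⁻¹ * ∑ l, r t l * J t l j)) t) {t : ℝ} (ht : 0 ≤ t) :
    rootMeanSq (r t) ≤ rootMeanSq (r 0) := by
  have hd := fun u hu => hasDerivAt_mean_sq (hr u hu)
  have hanti : AntitoneOn (fun u => (n : ℝ)⁻¹ * ∑ i, r u i ^ 2) (Set.Ici 0) := by
    refine antitoneOn_of_hasDerivWithinAt_nonpos (convex_Ici 0)
      (fun u hu => (hd u hu).continuousAt.continuousWithinAt)
      (fun u hu => (hd u (interior_subset hu)).hasDerivWithinAt) fun u _ => ?_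
    have : (n : ℝ)⁻¹ * ∑ i, r u i * ∑ j, J u i j * -((n : ℝ)⁻¹ * ∑ l, r u l * J u l j) =
        -∑ j, ((n : ℝ)⁻¹ * ∑ l, r u l * J u l j) ^ 2 := by
      simp_rw [Finset.mul_sum (s := (Finset.univ : Finset (Fin p)))]
      rw [Finset.sum_comm, Finset.mul_sum, ← Finset.sum_neg_distrib]
      refine Finset.sum_congr rfl fun j _ => ?_
      simp_rw [← mul_assoc]
      rw [← Finset.sum_mul]
      ring
    rw [this]
    have : 0 ≤ ∑ j, ((n : ℝ)⁻¹ * ∑ l, r u l * J u l j) ^ 2 := by positivity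
    linarith
  exact Real.sqrt_le_sqrt (hanti Set.self_mem_Ici ht ht)

theorem rootMeanSq_sub_le_of_flow {n p : ℕ} {J : ℝ → Fin n → Fin p → ℝ} {r q : ℝ → Fin n → ℝ}
    {B : ℝ} (hB : 0 ≤ B)
    (hr : ∀ t, 0 ≤ t → ∀ i, HasDerivAt (fun u => r u i)
      (∑ j, J t i j * -((n : ℝ)⁻¹ * ∑ l, r t l * J t l j)) t)
    (hq : ∀ t, 0 ≤ t → ∀ i, HasDerivAt (fun u => q u i)
      (∑ j, J 0 i j * -((n : ℝ)⁻¹ * ∑ l, q t l * J 0 l j)) t)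
    (h0 : r 0 = q 0)
    (hJ : ∀ t, 0 ≤ t → ∀ i l, |∑ j, J t i j * J t l j - ∑ j, J 0 i j * J 0 l j| ≤ B * t)
    {t : ℝ} (ht : 0 ≤ t) :
    rootMeanSq (r t - q t) ≤ B * rootMeanSq (r 0) * t ^ 2 / 2 := by
  refine sqrt_le_of_deriv_le (φ := fun u => (n : ℝ)⁻¹ * ∑ i, (r u - q u) i ^ 2)
    (mul_nonneg hB (rootMeanSq_nonneg _)) (by simp [h0]) (fun u _ => by positivity)
    (fun u hu => hasDerivAt_mean_sq (w := fun u => r u - q u)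
      fun i => (hr u hu i).sub (hq u hu i)) (fun u hu => ?_) ht
  change _ ≤ 2 * (rootMeanSq (r u - q u) * _)
  refine mul_le_mul_of_nonneg_left ?_ zero_le_two
  set w := r u - q u with hw
  set D : Fin n → Fin n → ℝ := fun i l => ∑ j, J u i j * J u l j - ∑ j, J 0 i j * J 0 l j with hD
  have hswap : ∀ (K : Fin n → Fin p → ℝ) (z : Fin n → ℝ) (i : Fin n),
      ∑ j, K i j * -((n : ℝ)⁻¹ * ∑ l, z l * K l j) =
        -((n : ℝ)⁻¹ * ∑ l, (∑ j, K i j * K l j) * z l) := fun K z i => by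
    simp_rw [Finset.sum_mul]
    rw [Finset.sum_comm, Finset.mul_sum, ← Finset.sum_neg_distrib]
    refine Finset.sum_congr rfl fun j _ => ?_
    rw [mul_neg, mul_left_comm, Finset.mul_sum]
    congr 2
    exact Finset.sum_congr rfl fun l _ => by ring
  have hpsd : 0 ≤ ∑ i, w i * ∑ l, (∑ j, J 0 i j * J 0 l j) * w l := by
    have : ∑ i, w i * ∑ l, (∑ j, J 0 i j * J 0 l j) * w l = ∑ j, (∑ i, w i * J 0 i j) ^ 2 := by
      simp_rw [sq, Finset.sum_mul_sum, Finset.mul_sum, Finset.sum_mul, Finset.mul_sum]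
      rw [Finset.sum_comm' (t' := Finset.univ) (s' := fun _ => Finset.univ) (by simp),
        Finset.sum_comm]
      simp_rw [Finset.sum_comm (γ := Fin p)]
      refine Finset.sum_congr rfl fun j _ => Finset.sum_congr rfl fun i _ =>
        Finset.sum_congr rfl fun l _ => by ring
    rw [this]
    positivity
  have hsplit : (n : ℝ)⁻¹ * ∑ i, w i * (∑ j, J u i j * -((n : ℝ)⁻¹ * ∑ l, r u l * J u l j) -
      ∑ j, J 0 i j * -((n : ℝ)⁻¹ * ∑ l, q u l * J 0 l j)) =
      -((n : ℝ)⁻¹ ^ 2 * ∑ i, w i * ∑ l, (∑ j, J 0 i j * J 0 l j) * w l) -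
        (n : ℝ)⁻¹ ^ 2 * ∑ i, w i * ∑ l, D i l * r u l := by
    have hterm : ∀ i, w i * (∑ j, J u i j * -((n : ℝ)⁻¹ * ∑ l, r u l * J u l j) -
        ∑ j, J 0 i j * -((n : ℝ)⁻¹ * ∑ l, q u l * J 0 l j)) =
        -((n : ℝ)⁻¹ * (w i * ∑ l, (∑ j, J 0 i j * J 0 l j) * w l + w i * ∑ l, D i l * r u l)) :=
      fun i => by
        have hsum : ∑ l, (∑ j, J 0 i j * J 0 l j) * w l + ∑ l, D i l * r u l =
            ∑ l, (∑ j, J u i j * J u l j) * r u l - ∑ l, (∑ j, J 0 i j * J 0 l j) * q u l := by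
          rw [← Finset.sum_add_distrib, ← Finset.sum_sub_distrib]
          refine Finset.sum_congr rfl fun l _ => ?_
          simp only [hD, hw, Pi.sub_apply]
          ring
        rw [hswap, hswap, ← mul_add, hsum]
        ring
    rw [Finset.sum_congr rfl fun i _ => hterm i, Finset.sum_neg_distrib, ← Finset.mul_sum,
      Finset.sum_add_distrib]
    ring
  have hpert : |(n : ℝ)⁻¹ ^ 2 * ∑ i, w i * ∑ l, D i l * r u l| ≤
      rootMeanSq w * (B * rootMeanSq (r 0) * u) := by
    have hin : ∀ i, |∑ l, D i l * r u l| ≤ B * u * ∑ l, |r u l| := fun i => by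
      rw [Finset.mul_sum]
      refine (Finset.abs_sum_le_sum_abs _ _).trans (Finset.sum_le_sum fun l _ => ?_)
      rw [abs_mul]
      exact mul_le_mul_of_nonneg_right (hJ u hu i l) (abs_nonneg _)
    have hout : |∑ i, w i * ∑ l, D i l * r u l| ≤ (∑ i, |w i|) * (B * u * ∑ l, |r u l|) := by
      rw [Finset.sum_mul]
      refine (Finset.abs_sum_le_sum_abs _ _).trans (Finset.sum_le_sum fun i _ => ?_)
      rw [abs_mul]
      exact mul_le_mul_of_nonneg_left (hin i) (abs_nonneg _)
    have hmean : (n : ℝ)⁻¹ * ∑ l, |r u l| ≤ rootMeanSq (r 0) :=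
      (mean_abs_le_rootMeanSq _).trans (rootMeanSq_le_of_flow hr hu)
    rw [abs_mul, abs_of_nonneg (by positivity)]
    calc (n : ℝ)⁻¹ ^ 2 * |∑ i, w i * ∑ l, D i l * r u l|
        ≤ (n : ℝ)⁻¹ ^ 2 * ((∑ i, |w i|) * (B * u * ∑ l, |r u l|)) := by gcongr
      _ = ((n : ℝ)⁻¹ * ∑ i, |w i|) * (B * u * ((n : ℝ)⁻¹ * ∑ l, |r u l|)) := by ring
      _ ≤ rootMeanSq w * (B * u * rootMeanSq (r 0)) := by
        gcongr
        · exact rootMeanSq_nonneg _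
        · exact mean_abs_le_rootMeanSq w
      _ = rootMeanSq w * (B * rootMeanSq (r 0) * u) := by ring
  have hpsd' := mul_nonneg (sq_nonneg (n : ℝ)⁻¹) hpsd
  rw [hsplit]
  linarith [neg_le_of_abs_le hpert]

theorem differentiable_modelF {m p d : ℕ} {f : Fin m → (Fin p → ℝ) → (Fin d → ℝ) → ℝ}
    (hf : ∀ k x, Differentiable ℝ fun Θ => f k Θ x) (x : Fin d → ℝ) :
    Differentiable ℝ fun Θ => modelF f Θ x :=
  (Differentiable.fun_sum fun k _ => hf k x).const_mul _

theorem pder_modelF {m p d : ℕ} {f : Fin m → (Fin p → ℝ) → (Fin d → ℝ) → ℝ}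
    (hf : ∀ k x, Differentiable ℝ fun Θ => f k Θ x) (x : Fin d → ℝ) (j : Fin p) (Θ : Fin p → ℝ) :
    pder j (fun Θ' => modelF f Θ' x) Θ = (√m)⁻¹ * ∑ k, pder j (fun Θ' => f k Θ' x) Θ := by
  have h := (HasFDerivAt.fun_sum (u := Finset.univ) fun k _ =>
    (hf k x Θ).hasFDerivAt).const_mul (√m)⁻¹
  unfold pder modelF
  rw [h.fderiv]
  simp

theorem hasFDerivAt_linF {m p d : ℕ} (f : Fin m → (Fin p → ℝ) → (Fin d → ℝ) → ℝ)
    (Θ₀ Θ : Fin p → ℝ) (x : Fin d → ℝ) :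
    HasFDerivAt (fun Θ' => linF f Θ₀ Θ' x)
      (∑ j, pder j (fun Θ' => modelF f Θ' x) Θ₀ •
        ContinuousLinearMap.proj (R := ℝ) (φ := fun _ : Fin p => ℝ) j) Θ :=
  (HasFDerivAt.fun_sum fun j _ =>
    ((hasFDerivAt_apply j Θ).sub_const (Θ₀ j)).const_mul _).const_add _

theorem pder_linF {m p d : ℕ} (f : Fin m → (Fin p → ℝ) → (Fin d → ℝ) → ℝ)
    (Θ₀ Θ : Fin p → ℝ) (x : Fin d → ℝ) (j : Fin p) :
    pder j (fun Θ' => linF f Θ₀ Θ' x) Θ = pder j (fun Θ' => modelF f Θ' x) Θ₀ := by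
  rw [pder, (hasFDerivAt_linF f Θ₀ Θ x).fderiv]
  simp [Pi.single_apply]

namespace IsLocalModel

variable {m p d : ℕ} {f : Fin m → (Fin p → ℝ) → (Fin d → ℝ) → ℝ}
  {N : Fin m → Finset (Fin p)} {s c : ℝ}

theorem differentiable (h : IsLocalModel f N s c) (k : Fin m) (x : Fin d → ℝ) :
    Differentiable ℝ fun Θ => f k Θ x :=
  (h.1 k x).differentiable (by norm_num)

theorem pder_eq_zero (h : IsLocalModel f N s c) {k : Fin m} {j : Fin p} (hj : j ∉ N k)
    (x : Fin d → ℝ) (Θ : Fin p → ℝ) : pder j (fun Θ' => f k Θ' x) Θ = 0 :=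
  pder_eq_zero_of_notMem (h.differentiable k x) (h.2.1 k x) hj Θ

/-- A sum over `k` whose terms vanish unless `j ∈ N k` has at most `s` nonzero terms. -/
theorem abs_sum_le (h : IsLocalModel f N s c) {j : Fin p} {a : Fin m → ℝ} {b : ℝ} (hb : 0 ≤ b)
    (ha : ∀ k, |a k| ≤ b) (h0 : ∀ k, j ∉ N k → a k = 0) : |∑ k, a k| ≤ s * b := by
  rw [← Finset.sum_subset (Finset.subset_univ (Finset.univ.filter fun k => j ∈ N k))
    (fun k _ hk => h0 k (by simpa using hk))]
  refine (Finset.abs_sum_le_sum_abs _ _).trans ((Finset.sum_le_card_nsmul _ _ b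
    fun k _ => ha k).trans ?_)
  rw [nsmul_eq_mul]
  exact mul_le_mul_of_nonneg_right (h.2.2.2.1 j) hb

theorem abs_pder_modelF_le (h : IsLocalModel f N s c) (hc : 0 ≤ c) (x : Fin d → ℝ) (j : Fin p)
    (Θ : Fin p → ℝ) : |pder j (fun Θ' => modelF f Θ' x) Θ| ≤ (√m)⁻¹ * (s * c) := by
  rw [pder_modelF h.differentiable, abs_mul, abs_of_nonneg (by positivity)]
  exact mul_le_mul_of_nonneg_left (h.abs_sum_le hc (fun k => h.2.2.2.2.1 k j Θ x)
    fun k hk => h.pder_eq_zero hk x Θ) (by positivity)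

theorem abs_pder_modelF_sub_le (h : IsLocalModel f N s c) (hc : 0 ≤ c) {Θ Θ' : Fin p → ℝ} {δ : ℝ}
    (hδ : 0 ≤ δ) (hΘ : ∀ j, |Θ j - Θ' j| ≤ δ) (hs : 0 ≤ s) (x : Fin d → ℝ) (j : Fin p) :
    |pder j (fun Θ' => modelF f Θ' x) Θ - pder j (fun Θ' => modelF f Θ' x) Θ'| ≤
      (√m)⁻¹ * (s * (c * (s * δ))) := by
  rw [pder_modelF h.differentiable, pder_modelF h.differentiable, ← mul_sub,
    ← Finset.sum_sub_distrib, abs_mul, abs_of_nonneg (by positivity)]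
  refine mul_le_mul_of_nonneg_left (h.abs_sum_le (by positivity) (fun k => ?_) fun k hk => by
    rw [h.pder_eq_zero hk, h.pder_eq_zero hk, sub_zero]) (by positivity)
  refine (abs_sub_le_of_abs_pder_le (S := N k)
    ((contDiff_pder (h.1 k x) j).differentiable one_ne_zero)
    (fun _ _ => pder_eq_of_forall_mem (h.2.1 k x) j)
    (fun i Θ => h.2.2.2.2.2 k i j Θ x) Θ Θ').trans (mul_le_mul_of_nonneg_left ?_ hc)
  refine (Finset.sum_le_card_nsmul _ _ δ fun i _ => hΘ i).trans ?_
  rw [nsmul_eq_mul]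
  exact mul_le_mul_of_nonneg_right (h.2.2.1 k) hδ

theorem abs_sum_pder_modelF_mul_le (h : IsLocalModel f N s c) (hm : 1 ≤ m) (hc : 0 ≤ c)
    (x : Fin d → ℝ) (Θ : Fin p → ℝ) {b : Fin p → ℝ} {β : ℝ} (hβ : 0 ≤ β) (hb : ∀ j, |b j| ≤ β) :
    |∑ j, pder j (fun Θ' => modelF f Θ' x) Θ * b j| ≤ √m * (s * (c * β)) := by
  simp_rw [pder_modelF h.differentiable, mul_assoc, ← Finset.mul_sum, Finset.sum_mul]
  rw [Finset.sum_comm, abs_mul, abs_of_nonneg (by positivity)]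
  have hk : ∀ k, |∑ j, pder j (fun Θ' => f k Θ' x) Θ * b j| ≤ s * (c * β) := fun k => by
    rw [← Finset.sum_subset (Finset.subset_univ (N k)) (fun j _ hj => by
      rw [h.pder_eq_zero hj, zero_mul])]
    refine (Finset.abs_sum_le_sum_abs _ _).trans ((Finset.sum_le_card_nsmul _ _ (c * β)
      fun j _ => ?_).trans ?_)
    · rw [abs_mul]
      exact mul_le_mul (h.2.2.2.2.1 k j Θ x) (hb j) (abs_nonneg _) hc
    · rw [nsmul_eq_mul]
      exact mul_le_mul_of_nonneg_right (h.2.2.1 k) (by positivity)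
  have hsum : |∑ k, ∑ j, pder j (fun Θ' => f k Θ' x) Θ * b j| ≤ m * (s * (c * β)) := by
    refine (Finset.abs_sum_le_sum_abs _ _).trans ((Finset.sum_le_card_nsmul _ _ _
      fun k _ => hk k).trans ?_)
    simp
  have hm' : (0 : ℝ) < m := by exact_mod_cast hm
  have hsq : (√m)⁻¹ * (m : ℝ) = √m := by
    rw [inv_mul_eq_div, Real.div_sqrt]
  calc _ ≤ (√m)⁻¹ * (m * (s * (c * β))) := by gcongr
    _ = √m * (s * (c * β)) := by rw [← mul_assoc, hsq]

/-- Stability of the tangent kernel of a local model. -/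
theorem abs_tangentKernel_sub_le (h : IsLocalModel f N s c) (hm : 1 ≤ m) (hc : 0 ≤ c) (hs : 0 ≤ s)
    {Θ Θ' : Fin p → ℝ} {δ : ℝ} (hδ : 0 ≤ δ) (hΘ : ∀ j, |Θ j - Θ' j| ≤ δ) (x x' : Fin d → ℝ) :
    |kernelK f Θ x x' - kernelK f Θ' x x'| ≤ 2 * s ^ 3 * c ^ 2 * δ := by
  have hm' : (0 : ℝ) < √m := Real.sqrt_pos.2 (by exact_mod_cast hm)
  have hβ : 0 ≤ (√m)⁻¹ * (s * (c * (s * δ))) := by positivity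
  have h1 := h.abs_sum_pder_modelF_mul_le hm hc x Θ hβ
    (h.abs_pder_modelF_sub_le hc hδ hΘ hs x')
  have h2 := h.abs_sum_pder_modelF_mul_le hm hc x' Θ' hβ
    (h.abs_pder_modelF_sub_le hc hδ hΘ hs x)
  have hval : √m * (s * (c * ((√m)⁻¹ * (s * (c * (s * δ)))))) = s ^ 3 * c ^ 2 * δ := by
    field_simp
  rw [hval] at h1 h2
  have hsplit : ∀ a b a' b' : Fin p → ℝ, ∑ j, a j * b j - ∑ j, a' j * b' j =
      ∑ j, a j * (b j - b' j) + ∑ j, b' j * (a j - a' j) := fun a b a' b' => by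
    rw [← Finset.sum_sub_distrib, ← Finset.sum_add_distrib]
    exact Finset.sum_congr rfl fun j _ => by ring
  rw [kernelK, kernelK, hsplit]
  refine (abs_add_le _ _).trans ?_
  linarith

end IsLocalModel

/-- Lazy training: the deviation between a local model trained by gradient flow and its
linearization trained by gradient flow satisfies `Δ(t) ≤ 4s⁴c³L(Θ(0))t²/√m`. -/
theorem lazy_training_deviation_bound
    {m p d n : ℕ} (hm : 1 ≤ m) (hp : 1 ≤ p) (hd : 1 ≤ d) {s c : ℝ} (hs : 1 ≤ s) (hc : 0 < c)
    (f : Fin m → (Fin p → ℝ) → (Fin d → ℝ) → ℝ) (N : Fin m → Finset (Fin p))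
    (hloc : IsLocalModel f N s c)
    (X : Fin n → Fin d → ℝ) (Y : Fin n → ℝ)
    (Θ Θbar : ℝ → Fin p → ℝ)
    (hflow : ∀ t : ℝ, 0 ≤ t → ∀ j : Fin p,
      HasDerivAt (fun u => Θ u j) (-(pder j (lossL f X Y) (Θ t))) t)
    (hflowbar : ∀ t : ℝ, 0 ≤ t → ∀ j : Fin p,
      HasDerivAt (fun u => Θbar u j) (-(pder j (linLoss f (Θ 0) X Y) (Θbar t))) t)
    (hinit : Θbar 0 = Θ 0) :
    ∀ t : ℝ, 0 ≤ t →
      devΔ f X Θ Θbar t ≤ 4 * s ^ 4 * c ^ 3 * lossL f X Y (Θ 0) * t ^ 2 / Real.sqrt m := by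
  intro t ht
  set J : ℝ → Fin n → Fin p → ℝ := fun u i j => pder j (fun Θ' => modelF f Θ' (X i)) (Θ u) with hJ
  set r : ℝ → Fin n → ℝ := fun u i => modelF f (Θ u) (X i) - Y i with hr
  set q : ℝ → Fin n → ℝ := fun u i => linF f (Θ 0) (Θbar u) (X i) - Y i with hq
  have hs0 : 0 ≤ s := zero_le_one.trans hs
  have hm' : (0 : ℝ) < √m := Real.sqrt_pos.2 (by exact_mod_cast hm)
  have hF := differentiable_modelF hloc.differentiable
  have hΘ : ∀ u : ℝ, 0 ≤ u → ∀ j, HasDerivAt (fun u => Θ u j)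
      (-((n : ℝ)⁻¹ * ∑ l, r u l * J u l j)) u := fun u hu j =>
    (hflow u hu j).congr_deriv (congrArg Neg.neg (pder_mean_sq Y (fun i => hF (X i) (Θ u)) j))
  have hΘbar : ∀ u : ℝ, 0 ≤ u → ∀ j, HasDerivAt (fun u => Θbar u j)
      (-((n : ℝ)⁻¹ * ∑ l, q u l * J 0 l j)) u := fun u hu j => by
    refine (hflowbar u hu j).congr_deriv (congrArg Neg.neg ((pder_mean_sq Y
      (fun i => (hasFDerivAt_linF f (Θ 0) (Θbar u) (X i)).differentiableAt) j).trans ?_))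
    simp_rw [pder_linF]
    rfl
  have hr' : ∀ u, 0 ≤ u → ∀ i, HasDerivAt (fun u => r u i)
      (∑ j, J u i j * -((n : ℝ)⁻¹ * ∑ l, r u l * J u l j)) u := fun u hu i =>
    (hasDerivAt_comp_pder (hF (X i) (Θ u)) (hΘ u hu)).sub_const (Y i)
  have hq' : ∀ u, 0 ≤ u → ∀ i, HasDerivAt (fun u => q u i)
      (∑ j, J 0 i j * -((n : ℝ)⁻¹ * ∑ l, q u l * J 0 l j)) u := fun u hu i => by
    have h := (hasDerivAt_comp_pder (hasFDerivAt_linF f (Θ 0) (Θbar u) (X i)).differentiableAt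
      (hΘbar u hu)).sub_const (Y i)
    simp_rw [pder_linF] at h
    exact h
  have h0 : r 0 = q 0 := by
    ext i
    simp [hr, hq, linF, hinit]
  set R := rootMeanSq (r 0) with hR
  have hR0 : 0 ≤ R := rootMeanSq_nonneg _
  have hspeed : ∀ u, 0 ≤ u → ∀ j, |-((n : ℝ)⁻¹ * ∑ l, r u l * J u l j)| ≤
      (√m)⁻¹ * (s * c) * R := fun u hu j => by
    have hsum : |∑ l, r u l * J u l j| ≤ (∑ l, |r u l|) * ((√m)⁻¹ * (s * c)) := by
      rw [Finset.sum_mul]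
      refine (Finset.abs_sum_le_sum_abs _ _).trans (Finset.sum_le_sum fun l _ => ?_)
      rw [abs_mul]
      exact mul_le_mul_of_nonneg_left (hloc.abs_pder_modelF_le hc.le _ _ _) (abs_nonneg _)
    have hmean : (n : ℝ)⁻¹ * ∑ l, |r u l| ≤ R :=
      (mean_abs_le_rootMeanSq _).trans (rootMeanSq_le_of_flow hr' hu)
    rw [abs_neg, abs_mul, abs_of_nonneg (by positivity)]
    calc (n : ℝ)⁻¹ * |∑ l, r u l * J u l j|
        ≤ (n : ℝ)⁻¹ * ((∑ l, |r u l|) * ((√m)⁻¹ * (s * c))) := by gcongr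
      _ = (√m)⁻¹ * (s * c) * ((n : ℝ)⁻¹ * ∑ l, |r u l|) := by ring
      _ ≤ (√m)⁻¹ * (s * c) * R := by gcongr
  have hmove : ∀ u, 0 ≤ u → ∀ j, |Θ u j - Θ 0 j| ≤ (√m)⁻¹ * (s * c) * R * u := fun u hu j => by
    have h := norm_image_sub_le_of_norm_deriv_le_segment' (f := fun u => Θ u j) (a := 0) (b := u)
      (fun v hv => (hΘ v hv.1 j).hasDerivWithinAt) (fun v hv => hspeed v hv.1 j) u ⟨hu, le_rfl⟩
    simpa using h
  have hkernel : ∀ u, 0 ≤ u → ∀ i l, |∑ j, J u i j * J u l j - ∑ j, J 0 i j * J 0 l j| ≤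
      2 * s ^ 4 * c ^ 3 * R / √m * u := fun u hu i l => by
    refine (hloc.abs_tangentKernel_sub_le hm hc.le hs0 (by positivity) (hmove u hu)
      (X i) (X l)).trans_eq ?_
    ring
  have hmain := rootMeanSq_sub_le_of_flow (by positivity) hr' hq' h0 hkernel ht
  have hdev : devΔ f X Θ Θbar t = rootMeanSq (r t - q t) := by
    simp [devΔ, rootMeanSq, hr, hq]
  have hloss : R ^ 2 = 2 * lossL f X Y (Θ 0) := by
    rw [hR, rootMeanSq_sq, lossL, ← Finset.mul_sum]
    ring
  have hloss0 : 0 ≤ lossL f X Y (Θ 0) := by nlinarith [sq_nonneg R]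
  rw [hdev]
  calc rootMeanSq (r t - q t) ≤ 2 * s ^ 4 * c ^ 3 * R / √m * R * t ^ 2 / 2 := hmain
    _ = s ^ 4 * c ^ 3 * R ^ 2 * t ^ 2 / √m := by ring
    _ = 2 * s ^ 4 * c ^ 3 * lossL f X Y (Θ 0) * t ^ 2 / √m := by rw [hloss]; ring
    _ ≤ 4 * s ^ 4 * c ^ 3 * lossL f X Y (Θ 0) * t ^ 2 / √m := by gcongr; norm_num
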